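/- arXiv:2210.12912 — 4 statements merged into one kernel-verified Lean document; each statement's English description precedes it below -/
import Mathlib

section
/- Let β > 0, σ > 0 and γ > 0. Then ∫_{−π}^{π} cos(x) μ^γ(dx) > 0; equivalently, ∫_{−π}^{π} cos(x) exp(−(2/σ²) v^γ(x)) dx > 0. -/
open Real MeasureTheory Filter Topology

/-- A nonzero real `t` and `1 - exp (-k t)` have the same sign. -/
theorem mul_one_sub_exp_neg_mul_pos {k t : ℝ} (hk : 0 < k) (ht : t ≠ 0) :
    0 < t * (1 - Real.exp (-k * t)) := by
  rcases lt_or_gt_of_ne ht with h | h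
  · exact mul_pos_of_neg_of_neg h (sub_neg.2 (Real.one_lt_exp_iff.2 (by nlinarith)))
  · exact mul_pos h (sub_pos.2 (Real.exp_lt_one_iff.2 (by nlinarith)))

theorem mul_one_sub_exp_neg_mul_nonneg {k : ℝ} (hk : 0 < k) (t : ℝ) :
    0 ≤ t * (1 - Real.exp (-k * t)) := by
  rcases eq_or_ne t 0 with rfl | h
  · simp
  · exact (mul_one_sub_exp_neg_mul_pos hk h).le

/-- For a periodic `C²` solution `u` of `β u - (σ² / 2) u'' + u'² / 2 = -γ cos`, the Gibbs density
`exp (-(2 / σ²) u)` correlates positively with `cos`. -/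
theorem integral_cos_mul_exp_pos {β σ γ : ℝ} (hβ : 0 < β) (hσ : 0 < σ) (hγ : 0 < γ) {u : ℝ → ℝ}
    (hper : Function.Periodic u (2 * π)) (hC2 : ContDiff ℝ 2 u)
    (hODE : ∀ x : ℝ, β * u x - σ ^ 2 / 2 * deriv (deriv u) x + (1 / 2) * (deriv u x) ^ 2
      = -γ * Real.cos x) :
    0 < ∫ x in (-π)..π, Real.cos x * Real.exp (-(2 / σ ^ 2) * u x) := by
  have hk : 0 < 2 / σ ^ 2 := by positivity
  have hC1 : ContDiff ℝ 1 (deriv u) :=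
    (contDiff_succ_iff_deriv (n := 1)).1 (by simpa [one_add_one_eq_two] using hC2) |>.2.2
  have hu : ∀ x, HasDerivAt u (deriv u x) x :=
    fun x => (hC2.differentiable (by norm_num) x).hasDerivAt
  have hu' : ∀ x, HasDerivAt (deriv u) (deriv (deriv u) x) x :=
    fun x => (hC1.differentiable (by norm_num) x).hasDerivAt
  have hc : Continuous u := hC2.continuous
  have hc' : Continuous (deriv u) := hC1.continuous
  set f : ℝ → ℝ := fun x => Real.exp (-(2 / σ ^ 2) * u x) with hf
  have hfc : Continuous f := by fun_prop
  have hfpos : ∀ x, 0 < f x := fun x => Real.exp_pos _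
  set h : ℝ → ℝ := fun x => 1 / 2 * deriv u x ^ 2 * (1 + f x) + β * (u x * (1 - f x)) with hh
  have hhc : Continuous h := by fun_prop
  have hfirst : ∀ x, 0 ≤ 1 / 2 * deriv u x ^ 2 * (1 + f x) := fun x => by
    have := hfpos x
    positivity
  have hnonneg : ∀ x, 0 ≤ h x := fun x =>
    add_nonneg (hfirst x) (mul_nonneg hβ.le (mul_one_sub_exp_neg_mul_nonneg hk _))
  -- Where `u ≠ 0`, the function `h` is positive; the ODE excludes `u = 0` near the origin.
  have hex : ∃ c ∈ Set.Icc (-π) π, 0 < h c := by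
    by_contra! hcon
    have hzero : u =ᶠ[𝓝 0] fun _ => 0 := by
      filter_upwards [Icc_mem_nhds (neg_lt_zero.2 Real.pi_pos) Real.pi_pos] with x hx
      by_contra hne
      exact absurd (hcon x hx) (not_le.2 (add_pos_of_nonneg_of_pos (hfirst x)
        (mul_pos hβ (mul_one_sub_exp_neg_mul_pos hk hne))))
    have h0 := hODE 0
    rw [hzero.eq_of_nhds, hzero.deriv.deriv_eq, hzero.deriv.eq_of_nhds] at h0
    simp at h0
    exact hγ.ne' h0
  have hint : 0 < ∫ x in (-π)..π, h x :=
    intervalIntegral.integral_pos (by linarith [Real.pi_pos]) hhc.continuousOn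
      (fun x _ => hnonneg x) hex
  set G : ℝ → ℝ := fun x => σ ^ 2 / 2 * (deriv u x * f x) - σ ^ 2 / 2 * deriv u x
    + γ * Real.sin x with hG
  have hGderiv : ∀ x, HasDerivAt G (γ * (Real.cos x * f x) - h x) x := fun x => by
    have hfd : HasDerivAt f (f x * (-(2 / σ ^ 2) * deriv u x)) x :=
      ((hu x).const_mul (-(2 / σ ^ 2))).exp
    refine (((((hu' x).mul hfd).const_mul (σ ^ 2 / 2)).sub ((hu' x).const_mul (σ ^ 2 / 2))).add
      ((Real.hasDerivAt_sin x).const_mul γ)).congr_deriv ?_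
    have hcancel : σ ^ 2 / 2 * (2 / σ ^ 2) = 1 := by field_simp
    simp only [hh]
    linear_combination (1 - f x) * hODE x - deriv u x ^ 2 * f x * hcancel
  have hend : u π = u (-π) ∧ deriv u π = deriv u (-π) := by
    have e : π = -π + 2 * π := by ring
    have hper' : Function.Periodic (deriv u) (2 * π) := fun x => by
      rw [← deriv_comp_add_const, funext hper]
    exact ⟨by conv_lhs => rw [e, hper], by conv_lhs => rw [e, hper']⟩
  have hFTC : ∫ x in (-π)..π, (γ * (Real.cos x * f x) - h x) = 0 := by
    rw [intervalIntegral.integral_eq_sub_of_hasDerivAt (fun x _ => hGderiv x)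
      (Continuous.intervalIntegrable (by fun_prop) _ _)]
    simp [hG, hf, hend.1, hend.2]
  rw [intervalIntegral.integral_sub (Continuous.intervalIntegrable (by fun_prop) _ _)
    (hhc.intervalIntegrable _ _), intervalIntegral.integral_const_mul] at hFTC
  exact pos_of_mul_pos_right (by linarith) hγ.le

/-- For `γ > 0`, `∫ cos dμ^γ > 0`; equivalently
`∫_{−π}^{π} cos(x) exp(−(2/σ²) v^γ(x)) dx > 0`. -/
theorem kuramoto_cos_integral_positive
    (β σ : ℝ) (hβ : 0 < β) (hσ : 0 < σ)
    (v : ℝ → ℝ → ℝ)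
    (hper : ∀ γ, 0 ≤ γ → Function.Periodic (v γ) (2 * π))
    (hC2 : ∀ γ, 0 ≤ γ → ContDiff ℝ 2 (v γ))
    (hODE : ∀ γ, 0 ≤ γ → ∀ x : ℝ,
      β * v γ x - σ ^ 2 / 2 * deriv (deriv (v γ)) x + (1 / 2) * (deriv (v γ) x) ^ 2
        = -γ * Real.cos x)
    (Z : ℝ → ℝ)
    (hZ : ∀ γ, Z γ = ∫ y in (-π)..π, Real.exp (-(2 / σ ^ 2) * v γ y))
    (γ : ℝ) (hγ : 0 < γ) :
    0 < (∫ x in (-π)..π, Real.cos x * Real.exp (-(2 / σ ^ 2) * v γ x)) / Z γ ∧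
    0 < ∫ x in (-π)..π, Real.cos x * Real.exp (-(2 / σ ^ 2) * v γ x) := by
  have hnum := integral_cos_mul_exp_pos hβ hσ hγ (hper γ hγ.le) (hC2 γ hγ.le) (hODE γ hγ.le)
  have hcont : Continuous (v γ) := (hC2 γ hγ.le).continuous
  have hZpos : 0 < Z γ := by
    rw [hZ]
    exact intervalIntegral.intervalIntegral_pos_of_pos
      (Continuous.intervalIntegrable (by fun_prop) _ _) (fun _ => Real.exp_pos _)
      (by linarith [Real.pi_pos])
  exact ⟨div_pos hnum hZpos, hnum⟩
end

section
/- Let β > 0, σ > 0 and γ ≥ 0. Then the derivative of v^γ satisfies |(v^γ)'(x)| ≤ γ/β for all x ∈ ℝ. -/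
open Real MeasureTheory Filter Topology

/-- Second-order necessary condition at a local maximum. -/
theorem IsLocalMax.second_deriv_nonpos {f g : ℝ → ℝ} {x c : ℝ}
    (hmax : IsLocalMax f x) (hf : ∀ y, HasDerivAt f (g y) y) (hg : HasDerivAt g c x) :
    c ≤ 0 := by
  by_contra! hc
  have hfg : deriv f = g := funext fun y => (hf y).deriv
  have hmin : IsLocalMin f x :=
    isLocalMin_of_deriv_deriv_pos (by rwa [hfg, hg.deriv]) hmax.deriv_eq_zero
      (hf x).continuousAt
  have hconst : f =ᶠ[𝓝 x] fun _ => f x := by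
    filter_upwards [hmax, hmin] with y h₁ h₂ using le_antisymm h₁ h₂
  have h0 : deriv (deriv f) x = 0 := by
    rw [hconst.deriv.deriv_eq]
    simp
  rw [hfg, hg.deriv] at h0
  exact hc.ne' h0

/-- A continuous periodic real function attains its maximum. -/
theorem Function.Periodic.exists_forall_le_of_continuous {f : ℝ → ℝ} {T : ℝ}
    (hper : Function.Periodic f T) (hT : 0 < T) (hf : Continuous f) :
    ∃ x, ∀ y, f y ≤ f x := by
  obtain ⟨x, -, hx⟩ := (isCompact_Icc (a := (0 : ℝ)) (b := T)).exists_isMaxOn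
    (Set.nonempty_Icc.2 hT.le) hf.continuousOn
  refine ⟨x, fun y => ?_⟩
  obtain ⟨z, hz, hyz⟩ := hper.exists_mem_Ico₀ hT y
  rw [hyz]
  exact hx (Set.Ico_subset_Icc_self hz)

/-- A periodic twice differentiable function has a global maximum point, where its derivative
vanishes and its second derivative is nonpositive. -/
theorem Function.Periodic.exists_max_deriv_eq_zero {f g h : ℝ → ℝ} {T : ℝ}
    (hper : Function.Periodic f T) (hT : 0 < T) (hf : ∀ y, HasDerivAt f (g y) y)
    (hg : ∀ y, HasDerivAt g (h y) y) :
    ∃ x, (∀ y, f y ≤ f x) ∧ g x = 0 ∧ h x ≤ 0 := by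
  obtain ⟨x, hx⟩ := hper.exists_forall_le_of_continuous hT
    (continuous_iff_continuousAt.2 fun y => (hf y).continuousAt)
  have hmax : IsLocalMax f x := Eventually.of_forall hx
  exact ⟨x, hx, hmax.hasDerivAt_eq_zero (hf x), hmax.second_deriv_nonpos hf (hg x)⟩

/-- `|(v^γ)'(x)| ≤ γ/β` for every `x`. -/
theorem kuramoto_value_derivative_bound
    (β σ : ℝ) (hβ : 0 < β) (hσ : 0 < σ)
    (v : ℝ → ℝ → ℝ)
    (hper : ∀ γ, 0 ≤ γ → Function.Periodic (v γ) (2 * π))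
    (hC2 : ∀ γ, 0 ≤ γ → ContDiff ℝ 2 (v γ))
    (hODE : ∀ γ, 0 ≤ γ → ∀ x : ℝ,
      β * v γ x - σ ^ 2 / 2 * deriv (deriv (v γ)) x + (1 / 2) * (deriv (v γ) x) ^ 2
        = -γ * Real.cos x)
    (γ : ℝ) (hγ : 0 ≤ γ) :
    ∀ x : ℝ, |deriv (v γ) x| ≤ γ / β := by
  set u := v γ
  have hu := hC2 γ hγ
  have hs : 0 < σ ^ 2 / 2 := by positivity
  have hu1 : ∀ y, HasDerivAt u (deriv u y) y := fun y =>
    (hu.differentiable (by norm_num) y).hasDerivAt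
  have hw : ContDiff ℝ 1 (deriv u) := ContDiff.deriv' (by simpa [one_add_one_eq_two] using hu)
  have hw1 : ∀ y, HasDerivAt (deriv u) (deriv (deriv u) y) y := fun y =>
    (hw.differentiable (by norm_num) y).hasDerivAt
  have hww : deriv (deriv u) = fun y =>
      (β * u y + (1 / 2) * (deriv u y) ^ 2 + γ * Real.cos y) / (σ ^ 2 / 2) := by
    funext y
    rw [eq_div_iff hs.ne']
    linarith [hODE γ hγ y]
  have hw2 : ∀ y, HasDerivAt (deriv (deriv u))
      ((β * deriv u y + deriv u y * deriv (deriv u) y - γ * Real.sin y) / (σ ^ 2 / 2)) y := by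
    intro y
    have h := ((((hu1 y).const_mul β).add (((hw1 y).pow 2).const_mul (1 / 2))).add
      ((Real.hasDerivAt_cos y).const_mul γ)).div_const (σ ^ 2 / 2)
    have h' := h.congr_of_eventuallyEq (f₁ := deriv (deriv u))
      (Eventually.of_forall fun t => congrFun hww t)
    refine h'.congr_deriv ?_
    push_cast
    ring
  have hwper : Function.Periodic (deriv u) (2 * π) := fun y => by
    rw [← deriv_comp_add_const, funext (hper γ hγ)]
  intro x
  rw [abs_le, ← neg_div, div_le_iff₀ hβ, le_div_iff₀ hβ]
  constructor
  · obtain ⟨z, hz, hz1, hz2⟩ := Function.Periodic.exists_max_deriv_eq_zero (f := -deriv u)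
      (fun y => congrArg Neg.neg (hwper y)) two_pi_pos
      (fun y => (hw1 y).neg) (fun y => (hw2 y).neg)
    rw [neg_eq_zero] at hz1
    rw [hz1, neg_nonpos, le_div_iff₀ hs] at hz2
    have h1 : deriv u z ≤ deriv u x := neg_le_neg_iff.1 (hz x)
    nlinarith [Real.neg_one_le_sin z]
  · obtain ⟨z, hz, hz1, hz2⟩ := hwper.exists_max_deriv_eq_zero two_pi_pos hw1 hw2
    rw [hz1, div_le_iff₀ hs] at hz2
    nlinarith [Real.sin_le_one z, hz x]
end

section
/- Let β > 0, σ > 0 and γ ≥ 0, and define h(x) := v^γ(x) + 2γ cos(x)/(2β + σ²). Then |h(x)| ≤ γ²/(2β³) for all x ∈ ℝ. -/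
open Real MeasureTheory Filter Topology

/-- A continuous periodic function attains a global maximum, where the first derivative vanishes
and the second derivative is nonpositive. -/
theorem Function.Periodic.exists_max_deriv_deriv_nonpos {f : ℝ → ℝ} {T : ℝ}
    (hf : Function.Periodic f T) (hT : T ≠ 0) (hc : Continuous f) :
    ∃ x₀, (∀ x, f x ≤ f x₀) ∧ deriv f x₀ = 0 ∧ deriv (deriv f) x₀ ≤ 0 := by
  obtain ⟨_, ⟨x₀, rfl⟩, hmax⟩ :=
    (hf.compact_of_continuous hT hc).exists_isGreatest (Set.range_nonempty f)
  have hle : ∀ x, f x ≤ f x₀ := fun x => hmax (Set.mem_range_self x)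
  have h1 : deriv f x₀ = 0 :=
    IsLocalMax.deriv_eq_zero (Eventually.of_forall hle)
  refine ⟨x₀, hle, h1, ?_⟩
  by_contra! hpos
  have hmin : IsLocalMin f x₀ := isLocalMin_of_deriv_deriv_pos hpos h1 hc.continuousAt
  have heq : f =ᶠ[𝓝 x₀] fun _ => f x₀ := by
    filter_upwards [hmin] with x hx using le_antisymm (hle x) hx
  have h2 := heq.deriv.deriv_eq
  simp [h2] at hpos

/-- A continuous periodic function attains a global minimum, where the first derivative vanishes
and the second derivative is nonnegative. -/
theorem Function.Periodic.exists_min_deriv_deriv_nonneg {f : ℝ → ℝ} {T : ℝ}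
    (hf : Function.Periodic f T) (hT : T ≠ 0) (hc : Continuous f) :
    ∃ x₀, (∀ x, f x₀ ≤ f x) ∧ deriv f x₀ = 0 ∧ 0 ≤ deriv (deriv f) x₀ := by
  have hp : Function.Periodic (fun x => -f x) T := fun x => by simp [hf x]
  obtain ⟨x₀, h0, h1, h2⟩ := hp.exists_max_deriv_deriv_nonpos hT hc.neg
  have hd : deriv (fun x => -f x) = fun x => -deriv f x := by
    ext x; exact deriv.fun_neg
  rw [hd, deriv.fun_neg] at h2
  rw [hd] at h1
  exact ⟨x₀, fun x => neg_le_neg_iff.mp (h0 x), neg_eq_zero.mp h1, by linarith⟩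

theorem Function.Periodic.periodic_deriv {f : ℝ → ℝ} {T : ℝ} (hf : Function.Periodic f T) :
    Function.Periodic (deriv f) T := fun x => by
  rw [← deriv_comp_add_const, show (fun x => f (x + T)) = f from funext hf]

/-- Gradient bound, by the maximum principle applied to the differentiated equation. -/
theorem abs_deriv_le_of_periodic_hamilton_jacobi {β σ γ : ℝ} (hβ : 0 < β) (hσ : 0 < σ)
    (hγ : 0 ≤ γ) {u : ℝ → ℝ} (hper : Function.Periodic u (2 * π)) (hC2 : ContDiff ℝ 2 u)
    (hODE : ∀ x : ℝ, β * u x - σ ^ 2 / 2 * deriv (deriv u) x + (1 / 2) * (deriv u x) ^ 2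
      = -γ * Real.cos x) (x : ℝ) :
    |deriv u x| ≤ γ / β := by
  have hσ2 : 0 < σ ^ 2 := by positivity
  have hT : 2 * π ≠ 0 := by positivity
  have hu : ∀ y, HasDerivAt u (deriv u y) y := fun y =>
    (hC2.differentiable (by norm_num) y).hasDerivAt
  have hC1 : ContDiff ℝ 1 (deriv u) := hC2.deriv'
  have hu' : ∀ y, HasDerivAt (deriv u) (deriv (deriv u) y) y := fun y =>
    (hC1.differentiable (by norm_num) y).hasDerivAt
  have hsecond : deriv (deriv u) =
      fun y => 2 / σ ^ 2 * (β * u y + 1 / 2 * (deriv u y) ^ 2 + γ * Real.cos y) := by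
    ext y
    have := hODE y
    field_simp
    linarith
  have hthird : ∀ y, β * deriv u y - σ ^ 2 / 2 * deriv (deriv (deriv u)) y
      + deriv u y * deriv (deriv u) y = γ * Real.sin y := by
    intro y
    have h := (((((hu y).const_mul β).add (((hu' y).pow 2).const_mul (1 / 2))).add
      ((Real.hasDerivAt_cos y).const_mul γ)).const_mul (2 / σ ^ 2)).deriv
    have h' : deriv (deriv (deriv u)) y = _ :=
      (congrArg (fun g => deriv g y) hsecond).trans h
    rw [h']
    field_simp
    norm_num
    ring
  obtain ⟨a, ha, ha1, ha2⟩ :=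
    hper.periodic_deriv.exists_max_deriv_deriv_nonpos hT hC1.continuous
  obtain ⟨b, hb, hb1, hb2⟩ :=
    hper.periodic_deriv.exists_min_deriv_deriv_nonneg hT hC1.continuous
  have hA := hthird a
  have hB := hthird b
  rw [ha1] at hA
  rw [hb1] at hB
  have hsa : γ * Real.sin a ≤ γ := mul_le_of_le_one_right hγ (Real.sin_le_one a)
  have hsb : -γ ≤ γ * Real.sin b := by nlinarith [Real.neg_one_le_sin b]
  have hpa := mul_nonneg_of_nonpos_of_nonpos (by linarith : -(σ ^ 2 / 2) ≤ 0) ha2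
  have hpb := mul_nonneg (by positivity : 0 ≤ σ ^ 2 / 2) hb2
  have hxa := mul_le_mul_of_nonneg_left (ha x) hβ.le
  have hxb := mul_le_mul_of_nonneg_left (hb x) hβ.le
  rw [le_div_iff₀ hβ, ← abs_of_pos hβ, ← abs_mul, abs_le]
  constructor <;> linarith

/-- The remainder `h(x) := v^γ(x) + 2γ cos(x)/(2β + σ²)` satisfies
`|h(x)| ≤ γ²/(2β³)` for all `x`. -/
theorem kuramoto_value_linearization_bound
    (β σ : ℝ) (hβ : 0 < β) (hσ : 0 < σ)
    (v : ℝ → ℝ → ℝ)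
    (hper : ∀ γ, 0 ≤ γ → Function.Periodic (v γ) (2 * π))
    (hC2 : ∀ γ, 0 ≤ γ → ContDiff ℝ 2 (v γ))
    (hODE : ∀ γ, 0 ≤ γ → ∀ x : ℝ,
      β * v γ x - σ ^ 2 / 2 * deriv (deriv (v γ)) x + (1 / 2) * (deriv (v γ) x) ^ 2
        = -γ * Real.cos x)
    (γ : ℝ) (hγ : 0 ≤ γ) :
    ∀ x : ℝ, |v γ x + 2 * γ * Real.cos x / (2 * β + σ ^ 2)| ≤ γ ^ 2 / (2 * β ^ 3) := by
  intro x
  have hσ2 : 0 < σ ^ 2 := by positivity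
  have hT : 2 * π ≠ 0 := by positivity
  have hgrad := abs_deriv_le_of_periodic_hamilton_jacobi hβ hσ hγ (hper γ hγ) (hC2 γ hγ)
    (hODE γ hγ)
  have hode := hODE γ hγ
  have hp := hper γ hγ
  have hC := hC2 γ hγ
  generalize v γ = u at *
  set c : ℝ := 2 * γ / (2 * β + σ ^ 2) with hc
  set h : ℝ → ℝ := fun y => u y + c * Real.cos y with hh
  have hhx : u x + 2 * γ * Real.cos x / (2 * β + σ ^ 2) = h x := by
    simp only [hh, hc]; ring
  have hd1 : deriv h = fun y => deriv u y + c * -Real.sin y := by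
    ext y
    exact ((hC.differentiable (by norm_num) y).hasDerivAt.add
      ((Real.hasDerivAt_cos y).const_mul c)).deriv
  have hC1 : ContDiff ℝ 1 (deriv u) := hC.deriv'
  have hd2 : ∀ y, deriv (deriv h) y = deriv (deriv u) y + c * -Real.cos y := by
    intro y
    rw [hd1]
    exact ((hC1.differentiable (by norm_num) y).hasDerivAt.add
      ((Real.hasDerivAt_sin y).neg.const_mul c)).deriv
  have hcγ : c * (2 * β + σ ^ 2) = 2 * γ := by
    rw [hc]; field_simp
  have hlin : ∀ y, β * h y - σ ^ 2 / 2 * deriv (deriv h) y = -(1 / 2) * (deriv u y) ^ 2 := by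
    intro y
    rw [hd2]
    simp only [hh]
    linear_combination hode y + Real.cos y / 2 * hcγ
  have hhp : Function.Periodic h (2 * π) := fun y => by
    simp only [hh, hp y, Real.cos_periodic y]
  have hhc : Continuous h := hC.continuous.add (Real.continuous_cos.const_mul c)
  obtain ⟨a, ha, -, ha2⟩ := hhp.exists_max_deriv_deriv_nonpos hT hhc
  obtain ⟨b, hb, -, hb2⟩ := hhp.exists_min_deriv_deriv_nonneg hT hhc
  have hpa := mul_nonneg_of_nonpos_of_nonpos (by linarith : -(σ ^ 2 / 2) ≤ 0) ha2
  have hpb := mul_nonneg (by positivity : 0 ≤ σ ^ 2 / 2) hb2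
  have hxa := mul_le_mul_of_nonneg_left (ha x) hβ.le
  have hxb := mul_le_mul_of_nonneg_left (hb x) hβ.le
  have hsq : (deriv u b) ^ 2 ≤ (γ / β) ^ 2 := sq_le_sq' (abs_le.mp (hgrad b)).1
    (abs_le.mp (hgrad b)).2
  have hup : β * h x ≤ 0 := by nlinarith [hlin a, sq_nonneg (deriv u a)]
  have hlow : -((γ / β) ^ 2 / 2) ≤ β * h x := by linarith [hlin b]
  rw [hhx, show γ ^ 2 / (2 * β ^ 3) = (γ / β) ^ 2 / 2 / β by field_simp, le_div_iff₀ hβ,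
    ← abs_of_pos hβ, ← abs_mul, abs_of_pos hβ, abs_le]
  constructor <;> nlinarith [sq_nonneg (γ / β)]
end

section
/- Let β > 0, σ > 0 and γ > 0, and set w^γ(x) := (v^γ(x) + γ/β)/√γ. Then |(w^γ)'(x)| ≤ (1/2)(3 + 2π + π² + σ²/β) for all x ∈ ℝ; equivalently, |(v^γ)'(x)| ≤ (√γ/2)(3 + 2π + π² + σ²/β) for all x. -/
open Real MeasureTheory Filter Topology

theorem Function.Periodic.exists_isMaxOn_univ {f : ℝ → ℝ} {c : ℝ} (hf : Function.Periodic f c)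
    (hc : 0 < c) (hcont : Continuous f) : ∃ x, ∀ y, f y ≤ f x := by
  obtain ⟨x, -, hx⟩ := isCompact_Icc.exists_isMaxOn (Set.nonempty_Icc.2 hc.le) hcont.continuousOn
  refine ⟨x, fun y => ?_⟩
  obtain ⟨z, hz, hyz⟩ := hf.exists_mem_Ico₀ hc y
  rw [hyz]
  exact hx (Set.Ico_subset_Icc_self hz)

theorem Function.Periodic.deriv {f : ℝ → ℝ} {c : ℝ} (hf : Function.Periodic f c) :
    Function.Periodic (deriv f) c := fun x => by
  rw [← deriv_comp_add_const, funext hf]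

theorem IsLocalMin.deriv_deriv_nonneg {f : ℝ → ℝ} {x : ℝ} (h : IsLocalMin f x)
    (hf : ContinuousAt f x) : 0 ≤ deriv (deriv f) x := by
  by_contra! hneg
  have hmax := isLocalMax_of_deriv_deriv_neg hneg h.deriv_eq_zero hf
  have hconst : f =ᶠ[𝓝 x] fun _ => f x := by
    filter_upwards [h, hmax] with y h1 h2 using le_antisymm h2 h1
  have h0 : deriv (deriv f) x = 0 := by
    rw [hconst.deriv.deriv_eq]
    simp
  exact hneg.ne h0

/-- A periodic classical solution of the stationary equation has slope at most `2 √γ`: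
the maximum principle gives `-γ / β ≤ v`, and the second derivative vanishes where `|v'|` is
maximal. -/
theorem abs_deriv_le_two_mul_sqrt_of_periodic_solution {β s γ c : ℝ} (hβ : 0 < β) (hs : 0 ≤ s)
    (hγ : 0 ≤ γ) (hc : 0 < c) {v : ℝ → ℝ} (hper : Function.Periodic v c) (hC2 : ContDiff ℝ 2 v)
    (hODE : ∀ x, β * v x - s * deriv (deriv v) x + (1 / 2) * (deriv v x) ^ 2 = -γ * Real.cos x)
    (x : ℝ) : |deriv v x| ≤ 2 * √γ := by
  have hd1 : ContDiff ℝ 1 (deriv v) := ((contDiff_succ_iff_deriv (n := 1)).1 hC2).2.2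
  have hlow : ∀ y, -γ ≤ β * v y := by
    obtain ⟨m, hm⟩ := (show Function.Periodic (fun y => -v y) c from
      fun y => by simp [hper y]).exists_isMaxOn_univ hc hC2.continuous.neg
    have hmin : IsLocalMin v m := Eventually.of_forall fun y => neg_le_neg_iff.1 (hm y)
    have h2 := mul_nonneg hs (hmin.deriv_deriv_nonneg hC2.continuous.continuousAt)
    have h3 := hODE m
    rw [hmin.deriv_eq_zero] at h3
    intro y
    have h4 := mul_le_mul_of_nonneg_left (neg_le_neg_iff.1 (hm y)) hβ.le
    nlinarith [Real.cos_le_one m]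
  obtain ⟨m, hm⟩ := (show Function.Periodic (fun y => deriv v y ^ 2) c from
    fun y => by simp [hper.deriv y]).exists_isMaxOn_univ hc (hd1.continuous.pow 2)
  have hcrit : 2 * deriv v m * deriv (deriv v) m = 0 := by
    have hmax : IsLocalMax (fun y => deriv v y ^ 2) m := Eventually.of_forall hm
    have hder := ((hd1.differentiable one_ne_zero m).hasDerivAt.pow 2)
    simpa using hmax.hasDerivAt_eq_zero hder
  have hmle : deriv v m ^ 2 ≤ 4 * γ := by
    rcases mul_eq_zero.1 hcrit with h | h
    · have h0 : deriv v m = 0 := by linarith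
      rw [h0]
      nlinarith
    · have h3 := hODE m
      rw [h] at h3
      nlinarith [hlow m, Real.neg_one_le_cos m]
  apply abs_le_of_sq_le_sq _ (by positivity)
  rw [mul_pow, Real.sq_sqrt hγ]
  linarith [hm x]

/-- uniform Lipschitz bound. For `γ > 0`, the scaled function
`w^γ(x) = (v^γ(x) + γ/β)/√γ` satisfies `|(w^γ)'(x)| ≤ (1/2)(3 + 2π + π² + σ²/β)`;
equivalently `|(v^γ)'(x)| ≤ (√γ/2)(3 + 2π + π² + σ²/β)`. -/
theorem kuramoto_scaled_value_lipschitz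
    (β σ : ℝ) (hβ : 0 < β) (hσ : 0 < σ)
    (v : ℝ → ℝ → ℝ)
    (hper : ∀ γ, 0 ≤ γ → Function.Periodic (v γ) (2 * π))
    (hC2 : ∀ γ, 0 ≤ γ → ContDiff ℝ 2 (v γ))
    (hODE : ∀ γ, 0 ≤ γ → ∀ x : ℝ,
      β * v γ x - σ ^ 2 / 2 * deriv (deriv (v γ)) x + (1 / 2) * (deriv (v γ) x) ^ 2
        = -γ * Real.cos x)
    (γ : ℝ) (hγ : 0 < γ) :
    (∀ x : ℝ,
      |deriv (fun y : ℝ => (v γ y + γ / β) / Real.sqrt γ) x|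
        ≤ (1 / 2) * (3 + 2 * π + π ^ 2 + σ ^ 2 / β)) ∧
    (∀ x : ℝ,
      |deriv (v γ) x| ≤ (Real.sqrt γ / 2) * (3 + 2 * π + π ^ 2 + σ ^ 2 / β)) := by
  have hmain : ∀ x, |deriv (v γ) x| ≤ (√γ / 2) * (3 + 2 * π + π ^ 2 + σ ^ 2 / β) := fun x => by
    have h := abs_deriv_le_two_mul_sqrt_of_periodic_solution hβ (by positivity : 0 ≤ σ ^ 2 / 2)
      hγ.le Real.two_pi_pos (hper γ hγ.le) (hC2 γ hγ.le) (hODE γ hγ.le) x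
    have hK : 4 ≤ 3 + 2 * π + π ^ 2 + σ ^ 2 / β := by
      have : 0 ≤ σ ^ 2 / β := by positivity
      nlinarith [Real.pi_gt_three]
    nlinarith [Real.sqrt_nonneg γ]
  refine ⟨fun x => ?_, hmain⟩
  have hsq := Real.sqrt_pos.2 hγ
  rw [deriv_div_const, deriv_add_const, abs_div, abs_of_pos hsq, div_le_iff₀ hsq]
  linarith [hmain x]
end
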